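/- Let n ≥ 2, let ρ be a density matrix on ℂ^d, and let O₂ be the average of P(τ) over all transpositions τ in the symmetric group on Fin n. Then the variance of O₂ in the state ρ^{⊗n} satisfies: tr(ρ^{⊗n}·O₂²) − (tr(ρ^{⊗n}·O₂))² = (1/C(n,2))·(1 − tr(ρ²)²) + (2(n−2)/C(n,2))·(tr(ρ³) − tr(ρ²)²), where C(n,2) = n(n−1)/2. -/

import Mathlib

open Matrix

/-- The permutation operator `P(π)` on `(ℂ^d)^{⊗n}`, as a matrix indexed by
functions `Fin n → Fin d`: its `(x, y)` entry is `1` if `y = x ∘ π` and `0` otherwise. -/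
noncomputable def permOp (n d : ℕ) (π : Equiv.Perm (Fin n)) :
    Matrix (Fin n → Fin d) (Fin n → Fin d) ℂ :=
  Matrix.of fun x y => if y = x ∘ ⇑π then 1 else 0

/-- The tensor power `ρ^{⊗n}` as a matrix indexed by `Fin n → Fin d`. -/
noncomputable def tensorPow (n d : ℕ) (ρ : Matrix (Fin d) (Fin d) ℂ) :
    Matrix (Fin n → Fin d) (Fin n → Fin d) ℂ :=
  Matrix.of fun x y => ∏ i, ρ (x i) (y i)

/-- The set of transpositions in the symmetric group on `Fin n`. -/
noncomputable def transpositions (n : ℕ) : Finset (Equiv.Perm (Fin n)) :=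
  @Finset.filter _ (fun τ : Equiv.Perm (Fin n) => τ.IsSwap) (Classical.decPred _)
    Finset.univ

/-- The observable `O_{(2)}`: the average of `P(τ)` over all transpositions `τ`. -/
noncomputable def O₂ (n d : ℕ) : Matrix (Fin n → Fin d) (Fin n → Fin d) ℂ :=
  ((transpositions n).card : ℂ)⁻¹ • ∑ τ ∈ transpositions n, permOp n d τ

/-- The contraction of a family of matrices `A` along the permutation `π`: the trace of
`⨂ A i` times the permutation operator of `π`. -/
noncomputable def permContraction {ι κ : Type*} [Fintype ι] [DecidableEq ι] [Fintype κ]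
    (A : ι → Matrix κ κ ℂ) (π : Equiv.Perm ι) : ℂ :=
  ∑ y : ι → κ, ∏ m, A m (y (π m)) (y m)

section Contraction

variable {ι κ : Type*} [Fintype ι] [DecidableEq ι] [Fintype κ]

theorem permContraction_one (A : ι → Matrix κ κ ℂ) :
    permContraction A 1 = ∏ m, (A m).trace := by
  simp only [permContraction, Matrix.trace, Matrix.diag_apply, Equiv.Perm.coe_one, id]
  rw [Finset.prod_univ_sum, Fintype.piFinset_univ]

/-- Summing out an index fixed by `π` removes a transposition. -/
theorem permContraction_mul_swap (A : ι → Matrix κ κ ℂ) (π : Equiv.Perm ι) {i j : ι}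
    (hij : i ≠ j) (hi : π i = i) (htr : (A i).trace = 1) :
    permContraction A (π * Equiv.swap i j) =
      permContraction (Function.update A j (A i * A j)) π := by
  have split : ∀ f : ι → ℂ, ∏ m, f m = f i * (f j * ∏ m ∈ (Finset.univ.erase i).erase j, f m) := by
    intro f
    rw [Finset.mul_prod_erase _ f (by simp [hij.symm]), Finset.mul_prod_erase _ f (by simp)]
  have hne : ∀ m, m ≠ i → π m ≠ i := fun m hm h => hm (π.injective (h.trans hi.symm))
  have hL : permContraction A (π * Equiv.swap i j) =
      ∑ p : (ι → κ) × κ, A i p.2 p.2 * ∏ m, A m (p.1 ((π * Equiv.swap i j) m)) (p.1 m) := by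
    rw [Fintype.sum_prod_type]
    simp only [← Finset.sum_mul]
    rw [show ∑ a, A i a a = 1 from htr]
    simp [permContraction]
  have hR : permContraction (Function.update A j (A i * A j)) π =
      ∑ p : (ι → κ) × κ, A i (p.1 i) (p.1 i) * (A i (p.1 (π j)) p.2 * A j p.2 (p.1 j) *
        ∏ m ∈ (Finset.univ.erase i).erase j, A m (p.1 (π m)) (p.1 m)) := by
    rw [Fintype.sum_prod_type]
    refine Finset.sum_congr rfl fun y _ => ?_
    have hrest : ∏ m ∈ (Finset.univ.erase i).erase j,
        Function.update A j (A i * A j) m (y (π m)) (y m) =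
          ∏ m ∈ (Finset.univ.erase i).erase j, A m (y (π m)) (y m) := by
      refine Finset.prod_congr rfl fun m hm => ?_
      rw [Function.update_of_ne (Finset.ne_of_mem_erase hm)]
    rw [split, hrest, Function.update_of_ne hij, hi, Function.update_self, Matrix.mul_apply]
    simp only [← Finset.mul_sum, ← Finset.sum_mul]
  rw [hL, hR]
  refine Finset.sum_nbij' (fun p => (Function.update p.1 i p.2, p.1 i))
    (fun p => (Function.update p.1 i p.2, p.1 i)) (by simp) (by simp) (by simp) (by simp) ?_
  rintro ⟨y, a⟩ -
  rw [split]
  simp only [Equiv.Perm.mul_apply, Equiv.swap_apply_left, Equiv.swap_apply_right, hi,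
    Function.update_self, Function.update_of_ne (hne j hij.symm), Function.update_of_ne hij.symm,
    mul_assoc]
  congr 3
  refine Finset.prod_congr rfl fun m hm => ?_
  have hmj := Finset.ne_of_mem_erase hm
  have hmi := Finset.ne_of_mem_erase (Finset.mem_of_mem_erase hm)
  rw [Equiv.swap_apply_of_ne_of_ne hmi hmj, Function.update_of_ne hmi,
    Function.update_of_ne (hne m hmi)]

theorem permContraction_const_one {ρ : Matrix κ κ ℂ} (htr : ρ.trace = 1) :
    permContraction (fun _ : ι => ρ) 1 = 1 := by
  simp [permContraction_one, htr]

theorem prod_trace_update {ρ B : Matrix κ κ ℂ} (htr : ρ.trace = 1) (j : ι) :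
    ∏ m, (Function.update (fun _ : ι => ρ) j B m).trace = B.trace := by
  rw [Finset.prod_eq_single j (fun m _ hm => by simp [Function.update_of_ne hm, htr]) (by simp)]
  simp

theorem permContraction_swap {ρ : Matrix κ κ ℂ} (htr : ρ.trace = 1) {i j : ι} (hij : i ≠ j) :
    permContraction (fun _ => ρ) (Equiv.swap i j) = (ρ * ρ).trace := by
  rw [← one_mul (Equiv.swap i j), permContraction_mul_swap _ _ hij rfl htr, permContraction_one,
    prod_trace_update htr]

theorem permContraction_swap_mul_swap_shared {ρ : Matrix κ κ ℂ} (htr : ρ.trace = 1) {i j k : ι}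
    (hij : i ≠ j) (hki : k ≠ i) (hkj : k ≠ j) :
    permContraction (fun _ => ρ) (Equiv.swap i j * Equiv.swap k j) = (ρ * (ρ * ρ)).trace := by
  rw [permContraction_mul_swap _ _ hkj (Equiv.swap_apply_of_ne_of_ne hki hkj) htr,
    ← one_mul (Equiv.swap i j), permContraction_mul_swap _ _ hij rfl
      (by simp [Function.update_of_ne hij, htr]), permContraction_one, Function.update_idem,
    prod_trace_update htr, Function.update_of_ne hij, Function.update_self]

theorem permContraction_swap_mul_swap_disjoint {ρ : Matrix κ κ ℂ} (htr : ρ.trace = 1)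
    {i j k l : ι} (hij : i ≠ j) (hkl : k ≠ l) (hki : k ≠ i) (hkj : k ≠ j) (hli : l ≠ i)
    (hlj : l ≠ j) :
    permContraction (fun _ => ρ) (Equiv.swap i j * Equiv.swap k l) = (ρ * ρ).trace ^ 2 := by
  rw [permContraction_mul_swap _ _ hkl (Equiv.swap_apply_of_ne_of_ne hki hkj) htr,
    ← one_mul (Equiv.swap i j), permContraction_mul_swap _ _ hij rfl
      (by simp [Function.update_of_ne hli.symm, htr]), permContraction_one,
    Function.update_of_ne hli.symm, Function.update_of_ne hlj.symm,
    ← Finset.mul_prod_erase _ _ (Finset.mem_univ j),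
    ← Finset.mul_prod_erase _ _ (Finset.mem_erase.2 ⟨hlj, Finset.mem_univ l⟩),
    Finset.prod_eq_one]
  · simp [Function.update_of_ne hlj, sq]
  · intro m hm
    simp only [Finset.mem_erase] at hm
    rw [Function.update_of_ne hm.2.1, Function.update_of_ne hm.1, htr]

/-- For `k ≠ l`, the value at a product of two transpositions, in terms of the indicators of
`k ∈ {i, j}` and `l ∈ {i, j}`. -/
theorem permContraction_swap_mul_swap {ρ : Matrix κ κ ℂ} (htr : ρ.trace = 1)
    {i j k l : ι} (hij : i ≠ j) (hkl : k ≠ l) (a : ι → ℂ)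
    (ha : ∀ m, a m = if m = i ∨ m = j then 1 else 0) :
    permContraction (fun _ => ρ) (Equiv.swap i j * Equiv.swap k l) =
      a k * a l + (ρ * (ρ * ρ)).trace * (a k * (1 - a l) + (1 - a k) * a l) +
        (ρ * ρ).trace ^ 2 * ((1 - a k) * (1 - a l)) := by
  have shared : ∀ {k l : ι}, k ≠ l → (l = i ∨ l = j) → ¬(k = i ∨ k = j) →
      permContraction (fun _ => ρ) (Equiv.swap i j * Equiv.swap k l) =
        (ρ * (ρ * ρ)).trace := by
    rintro k l - (rfl | rfl) hk <;> rw [not_or] at hk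
    · rw [Equiv.swap_comm l j]
      exact permContraction_swap_mul_swap_shared htr hij.symm hk.2 hk.1
    · exact permContraction_swap_mul_swap_shared htr hij hk.1 hk.2
  by_cases hk : k = i ∨ k = j <;> by_cases hl : l = i ∨ l = j
  · have h : Equiv.swap i j * Equiv.swap k l = 1 := by
      rcases hk with rfl | rfl <;> rcases hl with rfl | rfl
      · exact absurd rfl hkl
      · exact Equiv.swap_mul_self _ _
      · rw [Equiv.swap_comm k l]; exact Equiv.swap_mul_self _ _
      · exact absurd rfl hkl
    rw [h, permContraction_const_one htr, ha, ha, if_pos hk, if_pos hl]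
    ring
  · rw [Equiv.swap_comm k l, shared hkl.symm hk hl, ha, ha, if_pos hk, if_neg hl]
    ring
  · rw [shared hkl hl hk, ha, ha, if_pos hl, if_neg hk]
    ring
  · rw [ha, ha, if_neg hk, if_neg hl]
    rw [not_or] at hk hl
    rw [permContraction_swap_mul_swap_disjoint htr hij hkl hk.1 hk.2 hl.1 hl.2]
    ring

end Contraction

theorem permOp_mul (n d : ℕ) (π σ : Equiv.Perm (Fin n)) :
    permOp n d π * permOp n d σ = permOp n d (π * σ) := by
  ext x z
  simp only [permOp, Matrix.mul_apply, Matrix.of_apply, ite_mul, one_mul, zero_mul,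
    Finset.sum_ite_eq', Finset.mem_univ, if_true, Equiv.Perm.coe_mul,
    Function.comp_assoc]
  congr

theorem trace_tensorPow_mul_permOp (n d : ℕ) (ρ : Matrix (Fin d) (Fin d) ℂ)
    (π : Equiv.Perm (Fin n)) :
    (tensorPow n d ρ * permOp n d π).trace = permContraction (fun _ => ρ) π := by
  simp only [Matrix.trace, Matrix.diag_apply, Matrix.mul_apply, tensorPow, permOp,
    Matrix.of_apply, permContraction, mul_ite, mul_one, mul_zero]
  rw [Finset.sum_comm]
  refine Finset.sum_congr rfl fun y _ => ?_
  simp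

theorem two_mul_sum_transpositions (n : ℕ) (f : Equiv.Perm (Fin n) → ℂ) :
    2 * ∑ τ ∈ transpositions n, f τ =
      ∑ p ∈ (Finset.univ : Finset (Fin n)).offDiag, f (Equiv.swap p.1 p.2) := by
  have hmaps : ∀ p ∈ (Finset.univ : Finset (Fin n)).offDiag,
      Equiv.swap p.1 p.2 ∈ transpositions n := by
    intro p hp
    simp only [Finset.mem_offDiag] at hp
    simp only [transpositions, Finset.mem_filter, Finset.mem_univ, true_and]
    exact ⟨p.1, p.2, hp.2.2, rfl⟩
  rw [← Finset.sum_fiberwise_of_maps_to hmaps, Finset.mul_sum]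
  refine Finset.sum_congr rfl fun τ hτ => ?_
  simp only [transpositions, Finset.mem_filter, Finset.mem_univ, true_and] at hτ
  obtain ⟨a, b, hab, rfl⟩ := hτ
  have hfib : (Finset.univ : Finset (Fin n)).offDiag.filter
      (fun p => Equiv.swap p.1 p.2 = Equiv.swap a b) = {(a, b), (b, a)} := by
    ext ⟨k, l⟩
    simp only [Finset.mem_filter, Finset.mem_offDiag, Finset.mem_univ, true_and,
      Finset.mem_insert, Finset.mem_singleton, Prod.mk.injEq]
    constructor
    · rintro ⟨hkl, h⟩
      have h1 := congrArg (fun e : Equiv.Perm (Fin n) => e k) h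
      simp only [Equiv.swap_apply_left, Equiv.swap_apply_def] at h1
      split_ifs at h1 with h2 h3
      · exact Or.inl ⟨h2, h1⟩
      · exact Or.inr ⟨h3, h1⟩
      · exact absurd h1.symm hkl
    · rintro (⟨rfl, rfl⟩ | ⟨rfl, rfl⟩)
      · exact ⟨hab, rfl⟩
      · exact ⟨hab.symm, Equiv.swap_comm _ _⟩
  rw [hfib, Finset.sum_pair (by simp [hab])]
  simp only [Equiv.swap_comm b a]
  ring

theorem sum_offDiag_eq (n : ℕ) (f : Fin n × Fin n → ℂ) :
    ∑ p ∈ (Finset.univ : Finset (Fin n)).offDiag, f p =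
      ∑ i, ∑ j, f (i, j) - ∑ i, f (i, i) := by
  rw [← Finset.sum_product' (f := fun i j => f (i, j)), ← Finset.diag_union_offDiag,
    Finset.sum_union (Finset.disjoint_diag_offDiag _), Finset.sum_diag]
  ring

theorem card_transpositions (n : ℕ) :
    ((transpositions n).card : ℂ) = (n : ℂ) * ((n : ℂ) - 1) / 2 := by
  have h := two_mul_sum_transpositions n fun _ => 1
  rw [sum_offDiag_eq] at h
  simp at h
  linear_combination h / 2

theorem sum_permContraction_mul_transposition {n d : ℕ} {ρ : Matrix (Fin d) (Fin d) ℂ}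
    (htr : ρ.trace = 1) {σ : Equiv.Perm (Fin n)} (hσ : σ ∈ transpositions n) :
    ∑ τ ∈ transpositions n, permContraction (fun _ => ρ) (σ * τ) =
      1 + 2 * ((n : ℂ) - 2) * (ρ * (ρ * ρ)).trace +
        ((n : ℂ) - 2) * ((n : ℂ) - 3) / 2 * (ρ * ρ).trace ^ 2 := by
  simp only [transpositions, Finset.mem_filter, Finset.mem_univ, true_and] at hσ
  obtain ⟨i, j, hij, rfl⟩ := hσ
  have h := two_mul_sum_transpositions n
    fun τ => permContraction (fun _ => ρ) (Equiv.swap i j * τ)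
  set a : Fin n → ℂ := fun m => if m = i ∨ m = j then 1 else 0 with ha
  have hsum : ∑ m, a m = 2 := by
    rw [ha, Finset.sum_boole,
      show Finset.univ.filter (fun m => m = i ∨ m = j) = {i, j} by ext; simp,
      Finset.card_pair hij]
    norm_num
  have hsq : ∀ m, a m * a m = a m := fun m => by simp [ha]
  have hsum' : ∑ m, (1 - a m) = (n : ℂ) - 2 := by
    rw [Finset.sum_sub_distrib, hsum]; simp
  rw [Finset.sum_congr rfl fun p hp => permContraction_swap_mul_swap htr hij
    (Finset.mem_offDiag.1 hp).2.2 a fun _ => rfl, sum_offDiag_eq] at h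
  have hdiag : ∀ m, a m * a m + (ρ * (ρ * ρ)).trace * (a m * (1 - a m) + (1 - a m) * a m) +
      (ρ * ρ).trace ^ 2 * ((1 - a m) * (1 - a m)) =
      a m + (ρ * ρ).trace ^ 2 * (1 - a m) := fun m => by
    linear_combination (1 - 2 * (ρ * (ρ * ρ)).trace + (ρ * ρ).trace ^ 2) * hsq m
  simp only [hdiag] at h
  simp only [Finset.sum_add_distrib, ← Finset.mul_sum, ← Finset.sum_mul, hsum, hsum'] at h
  linear_combination h / 2

open scoped ComplexOrder in
theorem stmt5 (n d : ℕ) (hn : 2 ≤ n)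
    (ρ : Matrix (Fin d) (Fin d) ℂ) (hρ : ρ.PosSemidef) (htr : ρ.trace = 1) :
    (tensorPow n d ρ * (O₂ n d) ^ 2).trace - ((tensorPow n d ρ * O₂ n d).trace) ^ 2 =
      (1 / ((n : ℂ) * ((n : ℂ) - 1) / 2)) * (1 - ((ρ ^ 2).trace) ^ 2) +
        (2 * ((n : ℂ) - 2) / ((n : ℂ) * ((n : ℂ) - 1) / 2)) *
          ((ρ ^ 3).trace - ((ρ ^ 2).trace) ^ 2) := by
  have hn0 : (n : ℂ) ≠ 0 := by
    exact_mod_cast (by omega : n ≠ 0)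
  have hn1 : (n : ℂ) - 1 ≠ 0 := by
    rw [sub_ne_zero]
    exact_mod_cast (by omega : n ≠ 1)
  have h1 : (tensorPow n d ρ * O₂ n d).trace = (ρ * ρ).trace := by
    have hs : ∀ τ ∈ transpositions n, permContraction (fun _ => ρ) τ = (ρ * ρ).trace := by
      intro τ hτ
      simp only [transpositions, Finset.mem_filter, Finset.mem_univ, true_and] at hτ
      obtain ⟨i, j, hij, rfl⟩ := hτ
      exact permContraction_swap htr hij
    simp only [O₂, Matrix.mul_smul, Matrix.trace_smul, Finset.mul_sum, Matrix.trace_sum,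
      trace_tensorPow_mul_permOp]
    rw [Finset.sum_congr rfl hs, Finset.sum_const, nsmul_eq_mul, smul_eq_mul,
      card_transpositions]
    field_simp
  have h2 : (tensorPow n d ρ * O₂ n d ^ 2).trace =
      ((n : ℂ) * ((n : ℂ) - 1) / 2)⁻¹ * (1 + 2 * ((n : ℂ) - 2) * (ρ * (ρ * ρ)).trace +
        ((n : ℂ) - 2) * ((n : ℂ) - 3) / 2 * (ρ * ρ).trace ^ 2) := by
    rw [O₂, sq (_ • _), Matrix.smul_mul, Matrix.mul_smul, Matrix.mul_smul, Matrix.mul_smul,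
      Matrix.trace_smul, Matrix.trace_smul, Finset.sum_mul_sum]
    simp only [permOp_mul, Finset.mul_sum, Matrix.trace_sum, trace_tensorPow_mul_permOp]
    rw [Finset.sum_congr rfl fun σ hσ => sum_permContraction_mul_transposition htr hσ,
      Finset.sum_const, nsmul_eq_mul, smul_eq_mul, smul_eq_mul, card_transpositions]
    field_simp
  rw [h1, h2, pow_succ ρ 2, sq ρ, mul_assoc ρ ρ ρ]
  field_simp
  ring
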